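/- arXiv:2003.06684 — 2 statements merged into one kernel-verified Lean document; each statement's English description precedes it below -/
import Mathlib

section
/- (Theorem: uniform law of large numbers for the empirical measure in Wasserstein distance, in p-th mean.) Let p ∈ [1,∞) and let M be a family of Borel probability measures on ℝ^d with finite p-th moments such that lim_{r→∞} sup_{P∈M} ∫_{‖x‖>r} ‖x‖^p dP(x) = 0. For each P ∈ M and each n, let E_P[W_p^p(P̂_n, P)] denote the expectation, under an i.i.d. sample X₁,…,Xₙ from P, of the p-th power of the p-Wasserstein distance between the empirical distribution P̂_n and P. Then lim_{n→∞} sup_{P∈M} E_P[W_p^p(P̂_n, P)] = 0. -/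
open MeasureTheory ENNReal Filter Topology

noncomputable section

/-- `ℝ^d` as Euclidean space. -/
abbrev Euc (d : ℕ) : Type := EuclideanSpace ℝ (Fin d)

/-- The set of couplings of two Borel probability measures: probability measures on the
product space whose first marginal is `P` and second marginal is `Q`. -/
def couplings {E : Type*} [MeasurableSpace E] (P Q : Measure E) : Set (Measure (E × E)) :=
  {γ | IsProbabilityMeasure γ ∧ γ.map Prod.fst = P ∧ γ.map Prod.snd = Q}

/-- `W_p^p(P,Q)`: the `p`-th power of the `p`-Wasserstein distance,
`inf_{γ ∈ Γ(P,Q)} ∫ ‖x - y‖^p dγ(x,y)`, as an extended nonnegative real. -/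
def WpPow {E : Type*} [MeasurableSpace E] [NormedAddCommGroup E] (p : ℝ) (P Q : Measure E) :
    ℝ≥0∞ :=
  ⨅ γ ∈ couplings P Q, ∫⁻ z, ENNReal.ofReal (‖z.1 - z.2‖ ^ p) ∂γ

/-- The `p`-Wasserstein distance `W_p(P,Q)`. -/
def Wp {E : Type*} [MeasurableSpace E] [NormedAddCommGroup E] (p : ℝ) (P Q : Measure E) :
    ℝ≥0∞ :=
  WpPow p P Q ^ (1 / p)

/-- Empirical distribution `n⁻¹ ∑ᵢ δ_{x i}` of `n` points. -/
def empDist {E : Type*} [MeasurableSpace E] {n : ℕ} (x : Fin n → E) : Measure E :=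
  (n : ℝ≥0∞)⁻¹ • ∑ i, Measure.dirac (x i)

/-- The `n`-fold product measure `P^n` on `(ℝ^d)^n`. -/
def prodn {E : Type*} [MeasurableSpace E] (P : Measure E) (n : ℕ) : Measure (Fin n → E) :=
  Measure.pi fun _ => P

/-- `P` has a finite moment of order `p`. -/
def HasFinMom {E : Type*} [MeasurableSpace E] [NormedAddCommGroup E] (p : ℝ) (P : Measure E) :
    Prop :=
  ∫⁻ x, ENNReal.ofReal (‖x‖ ^ p) ∂P ≠ ∞

lemma aux_cp {E : Type*} [MeasurableSpace E] (μ ν : Measure E) [IsFiniteMeasure μ]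
    [IsFiniteMeasure ν] (h : μ Set.univ = ν Set.univ) :
    ∃ γ : Measure (E × E), γ.map Prod.fst = μ ∧ γ.map Prod.snd = ν := by
  refine ⟨(μ Set.univ)⁻¹ • μ.prod ν, ?_, ?_⟩
  · rw [Measure.map_smul, Measure.map_fst_prod, ← h, smul_smul]
    by_cases h0 : μ Set.univ = 0
    · rw [Measure.measure_univ_eq_zero] at h0
      simp [h0]
    · rw [ENNReal.inv_mul_cancel h0 (measure_ne_top _ _), one_smul]
  · rw [Measure.map_smul, Measure.map_snd_prod, smul_smul]
    by_cases h0 : μ Set.univ = 0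
    · have h1 := h0
      rw [h, Measure.measure_univ_eq_zero] at h1
      simp [h1]
    · rw [ENNReal.inv_mul_cancel h0 (measure_ne_top _ _), one_smul]

lemma aux_cost {E : Type*} [NormedAddCommGroup E] (p : ℝ) (hp : 1 ≤ p) (x y : E) :
    ENNReal.ofReal (‖x - y‖ ^ p) ≤ ENNReal.ofReal (2 ^ p) *
      (ENNReal.ofReal (‖x‖ ^ p) + ENNReal.ofReal (‖y‖ ^ p)) := by
  rw [← ENNReal.ofReal_add (by positivity) (by positivity), ← ENNReal.ofReal_mul (by positivity)]
  apply ENNReal.ofReal_le_ofReal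
  have h1 : ‖x - y‖ ≤ 2 * max ‖x‖ ‖y‖ := by
    have := norm_sub_le x y
    have := le_max_left ‖x‖ ‖y‖
    have := le_max_right ‖x‖ ‖y‖
    linarith
  calc ‖x - y‖ ^ p ≤ (2 * max ‖x‖ ‖y‖) ^ p := by
        apply Real.rpow_le_rpow (norm_nonneg _) h1 (by linarith)
    _ = 2 ^ p * (max ‖x‖ ‖y‖) ^ p := Real.mul_rpow (by norm_num) (by positivity)
    _ ≤ _ := by
      gcongr
      rcases max_choice ‖x‖ ‖y‖ with h | h <;> rw [h]
      · have : 0 ≤ ‖y‖ ^ p := by positivity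
        linarith
      · have : 0 ≤ ‖x‖ ^ p := by positivity
        linarith

/-- decomposition of a measure along a finite partition -/
lemma aux_decomp {E : Type*} [MeasurableSpace E] (P : Measure E) [IsProbabilityMeasure P]
    (f : E → ℕ) (hf : Measurable f) (K : ℕ) (hK : ∀ x, f x < K) :
    ∑ j ∈ Finset.range K, P.restrict (f ⁻¹' {j}) = P := by
  ext s hs
  rw [Measure.finsetSum_apply]
  simp_rw [Measure.restrict_apply hs]
  rw [← measure_biUnion_finset]
  · congr 1
    ext x
    simp [hK]
  · intro i _ j _ hij
    apply Set.disjoint_left.2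
    rintro x ⟨_, hx⟩ ⟨_, hy⟩
    exact hij (hx.symm.trans hy)
  · intro j _
    exact hs.inter (hf (measurableSet_singleton j))

lemma aux_scale {E : Type*} [MeasurableSpace E] (P : Measure E) [IsProbabilityMeasure P]
    (f : E → ℕ) (hf : Measurable f) (K : ℕ) (hK : ∀ x, f x < K) (m : ℕ → ℝ≥0∞)
    (hm : ∀ j, m j ≤ P (f ⁻¹' {j})) :
    ∃ (c : ℕ → ℝ≥0∞), (∀ j, c j ≤ 1) ∧ (∀ j, c j * P (f ⁻¹' {j}) = m j) ∧
      (∀ j, (1 - c j) * P (f ⁻¹' {j}) = P (f ⁻¹' {j}) - m j) ∧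
      (∑ j ∈ Finset.range K, c j • P.restrict (f ⁻¹' {j}))
        + (∑ j ∈ Finset.range K, (1 - c j) • P.restrict (f ⁻¹' {j})) = P := by
  have h1 : ∀ j, m j / P (f ⁻¹' {j}) ≤ 1 := fun j => ENNReal.div_le_of_le_mul (by simpa using hm j)
  have h2 : ∀ j, m j / P (f ⁻¹' {j}) * P (f ⁻¹' {j}) = m j := by
    intro j
    by_cases h0 : P (f ⁻¹' {j}) = 0
    · have := hm j
      rw [h0] at this ⊢
      simpa using (le_zero_iff.1 this).symm
    · exact ENNReal.div_mul_cancel h0 (measure_ne_top _ _)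
  refine ⟨fun j => m j / P (f ⁻¹' {j}), h1, h2, ?_, ?_⟩
  · intro j
    rw [ENNReal.sub_mul (fun _ _ => measure_ne_top _ _), h2, one_mul]
  · rw [← Finset.sum_add_distrib]
    conv_rhs => rw [← aux_decomp P f hf K hK]
    refine Finset.sum_congr rfl fun j _ => ?_
    rw [← add_smul, add_tsub_cancel_of_le (h1 j), one_smul]

/-- bound on the remainder moment -/
lemma aux_rem {E : Type*} [NormedAddCommGroup E] [MeasurableSpace E] [BorelSpace E]
    (p : ℝ) (hp : 1 ≤ p) (P : Measure E) [IsProbabilityMeasure P]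
    (f : E → ℕ) (hf : Measurable f) (K : ℕ) (m c : ℕ → ℝ≥0∞) (R : ℝ)
    (h0 : ∀ x, f x = 0 ↔ R < ‖x‖)
    (hc : ∀ j, (1 - c j) * P (f ⁻¹' {j}) = P (f ⁻¹' {j}) - m j) :
    ∫⁻ x, ENNReal.ofReal (‖x‖ ^ p) ∂(∑ j ∈ Finset.range K, (1 - c j) • P.restrict (f ⁻¹' {j}))
      ≤ ∫⁻ x in {x : E | R < ‖x‖}, ENNReal.ofReal (‖x‖ ^ p) ∂P
        + ∑ j ∈ (Finset.range K).erase 0, ENNReal.ofReal (R ^ p) * (P (f ⁻¹' {j}) - m j) := by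
  rw [lintegral_finsetSum_measure]
  simp_rw [lintegral_smul_measure]
  have hj : ∀ j, j ≠ 0 → (1 - c j) • ∫⁻ x in f ⁻¹' {j}, ENNReal.ofReal (‖x‖ ^ p) ∂P
      ≤ ENNReal.ofReal (R ^ p) * (P (f ⁻¹' {j}) - m j) := by
    intro j hj
    rw [← hc, smul_eq_mul, mul_left_comm]
    gcongr
    calc _ ≤ ∫⁻ x in f ⁻¹' {j}, ENNReal.ofReal (R ^ p) ∂P := by
          apply setLIntegral_mono' (hf (measurableSet_singleton j))
          intro x hx
          apply ENNReal.ofReal_le_ofReal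
          apply Real.rpow_le_rpow (norm_nonneg _) _ (by linarith)
          by_contra hh
          have := (h0 x).2 (not_le.1 hh)
          exact hj (hx.symm.trans this)
      _ = _ := by simp
  have hA : f ⁻¹' {0} = {x : E | R < ‖x‖} := by
    ext x
    simp [h0]
  by_cases hK : 0 ∈ Finset.range K
  · rw [← Finset.add_sum_erase _ _ hK]
    gcongr with j hjj
    · rw [hA, smul_eq_mul]
      exact mul_le_of_le_one_left zero_le tsub_le_self
    · exact hj j (Finset.ne_of_mem_erase hjj)
  · have : K = 0 := by simpa using hK
    subst this
    simp

lemma aux_det {E : Type*} [NormedAddCommGroup E] [MeasurableSpace E] [BorelSpace E]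
    [SecondCountableTopology E]
    (p : ℝ) (hp : 1 ≤ p) (P Q : Measure E) [IsProbabilityMeasure P] [IsProbabilityMeasure Q]
    (f : E → ℕ) (hf : Measurable f) (K : ℕ) (hK : ∀ x, f x < K) (R ε : ℝ) 
    (h0 : ∀ x, f x = 0 ↔ R < ‖x‖)
    (hε : ∀ x y, f x ≠ 0 → f x = f y → ‖x - y‖ ≤ ε) :
    WpPow p Q P ≤ ENNReal.ofReal (ε ^ p) + ENNReal.ofReal (2 ^ p) *
      ((∫⁻ x in {x : E | R < ‖x‖}, ENNReal.ofReal (‖x‖ ^ p) ∂Q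
        + ∑ j ∈ (Finset.range K).erase 0, ENNReal.ofReal (R ^ p) *
          (Q (f ⁻¹' {j}) - P (f ⁻¹' {j})))
      + (∫⁻ x in {x : E | R < ‖x‖}, ENNReal.ofReal (‖x‖ ^ p) ∂P
        + ∑ j ∈ (Finset.range K).erase 0, ENNReal.ofReal (R ^ p) *
          (P (f ⁻¹' {j}) - Q (f ⁻¹' {j})))) := by
  set m : ℕ → ℝ≥0∞ := fun j => if j = 0 then 0 else min (P (f ⁻¹' {j})) (Q (f ⁻¹' {j})) with hm
  have hmP : ∀ j, m j ≤ P (f ⁻¹' {j}) := by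
    intro j; simp only [hm]; split_ifs <;> simp
  have hmQ : ∀ j, m j ≤ Q (f ⁻¹' {j}) := by
    intro j; simp only [hm]; split_ifs <;> simp
  obtain ⟨c, c1, c2, c3, c4⟩ := aux_scale P f hf K hK m hmP
  obtain ⟨e, e1, e2, e3, e4⟩ := aux_scale Q f hf K hK m hmQ
  have hrP := aux_rem p hp P f hf K m c R h0 c3
  have hrQ := aux_rem p hp Q f hf K m e R h0 e3
  have hPm : ∀ j ∈ (Finset.range K).erase 0, P (f ⁻¹' {j}) - m j
      = P (f ⁻¹' {j}) - Q (f ⁻¹' {j}) := by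
    intro j hj
    simp only [hm, if_neg (Finset.ne_of_mem_erase hj)]
    rcases le_total (P (f ⁻¹' {j})) (Q (f ⁻¹' {j})) with h | h
    · rw [min_eq_left h, tsub_self, tsub_eq_zero_of_le h]
    · rw [min_eq_right h]
  have hQm : ∀ j ∈ (Finset.range K).erase 0, Q (f ⁻¹' {j}) - m j
      = Q (f ⁻¹' {j}) - P (f ⁻¹' {j}) := by
    intro j hj
    simp only [hm, if_neg (Finset.ne_of_mem_erase hj)]
    rcases le_total (P (f ⁻¹' {j})) (Q (f ⁻¹' {j})) with h | h
    · rw [min_eq_left h]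
    · rw [min_eq_right h, tsub_self, tsub_eq_zero_of_le h]
  rw [Finset.sum_congr (s₁ := (Finset.range K).erase 0) rfl fun j hj => by rw [hPm j hj]] at hrP
  rw [Finset.sum_congr (s₁ := (Finset.range K).erase 0) rfl fun j hj => by rw [hQm j hj]] at hrQ
  set μ' := ∑ j ∈ Finset.range K, (1 - c j) • P.restrict (f ⁻¹' {j}) with hμ'
  set ν' := ∑ j ∈ Finset.range K, (1 - e j) • Q.restrict (f ⁻¹' {j}) with hν'
  have hfinc : ∀ j, IsFiniteMeasure (c j • P.restrict (f ⁻¹' {j})) := fun j =>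
    Measure.smul_finite _ (ne_top_of_le_ne_top one_ne_top (c1 j))
  have hfine : ∀ j, IsFiniteMeasure (e j • Q.restrict (f ⁻¹' {j})) := fun j =>
    Measure.smul_finite _ (ne_top_of_le_ne_top one_ne_top (e1 j))
  have mP : (∑ j ∈ Finset.range K, m j) + μ' Set.univ = 1 := by
    have := congrArg (fun μ : Measure E => μ Set.univ) c4
    simpa [Measure.finsetSum_apply, c2] using this
  have mQ : (∑ j ∈ Finset.range K, m j) + ν' Set.univ = 1 := by
    have := congrArg (fun μ : Measure E => μ Set.univ) e4
    simpa [Measure.finsetSum_apply, e2] using this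
  have hm1 : (∑ j ∈ Finset.range K, m j) ≤ 1 := by rw [← mP]; exact le_self_add
  have hmtop : (∑ j ∈ Finset.range K, m j) ≠ ∞ := ne_top_of_le_ne_top one_ne_top hm1
  have hmass : ν' Set.univ = μ' Set.univ :=
    (ENNReal.add_right_inj hmtop).1 (mQ.trans mP.symm)
  have : IsFiniteMeasure μ' := ⟨by
    refine lt_of_le_of_lt ?_ one_lt_top
    rw [← mP]; exact le_add_self⟩
  have : IsFiniteMeasure ν' := ⟨by rw [hmass]; exact measure_lt_top _ _⟩
  obtain ⟨γ', g1, g2⟩ := aux_cp ν' μ' hmass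
  have hcell : ∀ j, ∃ γ : Measure (E × E), γ.map Prod.fst = e j • Q.restrict (f ⁻¹' {j}) ∧
      γ.map Prod.snd = c j • P.restrict (f ⁻¹' {j}) := by
    intro j
    apply aux_cp
    simp [c2, e2]
  choose γ k1 k2 using hcell
  have hmapsum : ∀ (g : E × E → E), Measurable g →
      (∑ j ∈ Finset.range K, γ j).map g = ∑ j ∈ Finset.range K, (γ j).map g := by
    intro g hg
    ext s hs
    simp [Measure.map_apply hg hs, Measure.finsetSum_apply]
  have hG1 : ((∑ j ∈ Finset.range K, γ j) + γ').map Prod.fst = Q := by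
    rw [Measure.map_add _ _ measurable_fst, hmapsum _ measurable_fst, g1, ← e4]
    simp_rw [k1]
  have hG2 : ((∑ j ∈ Finset.range K, γ j) + γ').map Prod.snd = P := by
    rw [Measure.map_add _ _ measurable_snd, hmapsum _ measurable_snd, g2, ← c4]
    simp_rw [k2]
  have hmem : (∑ j ∈ Finset.range K, γ j) + γ' ∈ couplings Q P := by
    refine ⟨⟨?_⟩, hG1, hG2⟩
    rw [← Set.preimage_univ (f := Prod.fst), ← Measure.map_apply measurable_fst MeasurableSet.univ,
      hG1, measure_univ]
  refine (iInf₂_le _ hmem).trans ?_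
  rw [lintegral_add_measure, lintegral_finsetSum_measure]
  have ha : Measurable fun x : E => ENNReal.ofReal (‖x‖ ^ p) := by fun_prop
  refine add_le_add ?_ ?_
  · calc _ ≤ ∑ j ∈ Finset.range K, ENNReal.ofReal (ε ^ p) * m j := by
          refine Finset.sum_le_sum fun j _ => ?_
          have hun : γ j Set.univ = m j := by
            rw [← Set.preimage_univ (f := Prod.fst),
              ← Measure.map_apply measurable_fst MeasurableSet.univ, k1]
            simp [e2]
          by_cases hj : j = 0
          · have : γ j = 0 := by
              rw [← Measure.measure_univ_eq_zero, hun]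
              simp [hm, hj]
            simp [this]
          have hA := hf (measurableSet_singleton j)
          have a1 : ∀ᵐ z ∂(γ j), z.1 ∈ f ⁻¹' {j} := by
            apply ae_of_ae_map (p := fun x => x ∈ f ⁻¹' {j}) measurable_fst.aemeasurable
            rw [k1]
            exact Measure.ae_smul_measure (ae_restrict_mem hA) _
          have a2 : ∀ᵐ z ∂(γ j), z.2 ∈ f ⁻¹' {j} := by
            apply ae_of_ae_map (p := fun x => x ∈ f ⁻¹' {j}) measurable_snd.aemeasurable
            rw [k2]
            exact Measure.ae_smul_measure (ae_restrict_mem hA) _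
          calc _ ≤ ∫⁻ z, ENNReal.ofReal (ε ^ p) ∂(γ j) := by
                apply lintegral_mono_ae
                filter_upwards [a1, a2] with z h1 h2
                apply ENNReal.ofReal_le_ofReal
                apply Real.rpow_le_rpow (norm_nonneg _) _ (by linarith)
                simp only [Set.mem_preimage, Set.mem_singleton_iff] at h1 h2
                exact hε _ _ (by rw [h1]; exact hj) (h1.trans h2.symm)
            _ = _ := by rw [lintegral_const, hun]
      _ = ENNReal.ofReal (ε ^ p) * ∑ j ∈ Finset.range K, m j := by rw [Finset.mul_sum]
      _ ≤ _ := mul_le_of_le_one_right zero_le hm1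
  · calc _ ≤ ∫⁻ z, ENNReal.ofReal (2 ^ p) *
          (ENNReal.ofReal (‖z.1‖ ^ p) + ENNReal.ofReal (‖z.2‖ ^ p)) ∂γ' :=
          lintegral_mono fun z => aux_cost p hp z.1 z.2
      _ = ENNReal.ofReal (2 ^ p) * (∫⁻ x, ENNReal.ofReal (‖x‖ ^ p) ∂ν'
            + ∫⁻ x, ENNReal.ofReal (‖x‖ ^ p) ∂μ') := by
          rw [lintegral_const_mul _ (by fun_prop), lintegral_add_left (by fun_prop), ← g1, ← g2,
            lintegral_map ha measurable_fst, lintegral_map ha measurable_snd]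
      _ ≤ _ := by gcongr

lemma aux_part {E : Type*} [NormedAddCommGroup E] [MeasurableSpace E] [BorelSpace E]
    [SecondCountableTopology E] [ProperSpace E] (R ε : ℝ) (hε : 0 < ε) :
    ∃ (f : E → ℕ) (K : ℕ), Measurable f ∧ (∀ x, f x < K) ∧ (∀ x, f x = 0 ↔ R < ‖x‖) ∧
      (∀ x y, f x ≠ 0 → f x = f y → ‖x - y‖ ≤ ε) := by
  classical
  let e := TopologicalSpace.denseSeq E
  obtain ⟨t, ht⟩ := (isCompact_closedBall (0 : E) R).elim_finite_subcover
    (fun k => Metric.ball (e k) (ε / 2)) (fun k => Metric.isOpen_ball) (by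
      intro x _
      obtain ⟨k, hk⟩ := (TopologicalSpace.denseRange_denseSeq E).exists_dist_lt x (half_pos hε)
      exact Set.mem_iUnion.2 ⟨k, hk⟩)
  let N := t.sup id
  have hnear : ∀ x : E, ‖x‖ ≤ R → dist (SimpleFunc.nearestPt e N x) x ≤ ε / 2 := by
    intro x hx
    have := ht (by simpa using hx : x ∈ Metric.closedBall (0 : E) R)
    simp only [Set.mem_iUnion] at this
    obtain ⟨k, hk, hxk⟩ := this
    have h1 := SimpleFunc.edist_nearestPt_le e x (Finset.le_sup (f := id) hk : k ≤ N)
    rw [edist_dist, edist_dist] at h1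
    have h2 := (ENNReal.ofReal_le_ofReal_iff dist_nonneg).1 h1
    rw [Metric.mem_ball, dist_comm] at hxk
    exact h2.trans hxk.le
  let g := SimpleFunc.nearestPtInd e N
  have hg : ∀ x, g x ≤ N := fun x => SimpleFunc.nearestPtInd_le e N x
  refine ⟨fun x => if R < ‖x‖ then 0 else g x + 1, N + 2, ?_, ?_, ?_, ?_⟩
  · refine Measurable.ite (measurableSet_lt measurable_const measurable_norm) measurable_const ?_
    exact g.measurable.add_const 1
  · intro x
    have := hg x
    dsimp only
    split_ifs <;> omega
  · intro x
    dsimp only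
    split_ifs with h <;> simp [h]
  · intro x y
    dsimp only
    split_ifs with h1 h2 h2
    · simp
    · simp
    · simp
    · intro _ h
      have h3 : g x = g y := by omega
      have h4 := hnear x (not_lt.1 h1)
      have h5 := hnear y (not_lt.1 h2)
      have h6 : SimpleFunc.nearestPt e N x = SimpleFunc.nearestPt e N y := by
        show e (g x) = e (g y)
        rw [h3]
      rw [← h6] at h5
      rw [dist_comm] at h4
      rw [← dist_eq_norm]
      linarith [dist_triangle x (SimpleFunc.nearestPt e N x) y]

lemma aux_emp_prob {E : Type*} [MeasurableSpace E] {n : ℕ} (hn : n ≠ 0) (x : Fin n → E) :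
    IsProbabilityMeasure (empDist x) := by
  constructor
  simp only [empDist, Measure.smul_apply, Measure.finsetSum_apply, measure_univ, smul_eq_mul]
  simp only [Finset.sum_const, Finset.card_univ, Fintype.card_fin, nsmul_eq_mul, mul_one]
  exact ENNReal.inv_mul_cancel (by exact_mod_cast hn) (natCast_ne_top n)

lemma aux_mean {E : Type*} [MeasurableSpace E] (P : Measure E) [IsProbabilityMeasure P]
    {n : ℕ} (hn : n ≠ 0) (a : E → ℝ≥0∞) (ha : Measurable a) (s : Set E) (hs : MeasurableSet s) :
    ∫⁻ x, ∫⁻ y in s, a y ∂(empDist x) ∂(prodn P n) = ∫⁻ y in s, a y ∂P := by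
  have hi : Measurable (s.indicator a) := ha.indicator hs
  have h1 : ∀ x : Fin n → E, ∫⁻ y in s, a y ∂(empDist x)
      = (n : ℝ≥0∞)⁻¹ * ∑ i, s.indicator a (x i) := by
    intro x
    rw [← lintegral_indicator hs, empDist, lintegral_smul_measure, lintegral_finsetSum_measure]
    simp_rw [lintegral_dirac' _ hi]
    rfl
  simp_rw [h1]
  rw [lintegral_const_mul _ (by fun_prop), lintegral_finsetSum _ (by fun_prop)]
  have h2 : ∀ i : Fin n, ∫⁻ x, s.indicator a (x i) ∂(prodn P n) = ∫⁻ y in s, a y ∂P := by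
    intro i
    rw [← lintegral_indicator hs]
    exact (measurePreserving_eval (fun _ : Fin n => P) i).lintegral_comp hi
  simp_rw [h2]
  simp only [Finset.sum_const, Finset.card_univ, Fintype.card_fin, nsmul_eq_mul]
  rw [← mul_assoc, ENNReal.inv_mul_cancel (by exact_mod_cast hn) (natCast_ne_top n), one_mul]

lemma aux_var {E : Type*} [MeasurableSpace E] (P : Measure E) [IsProbabilityMeasure P]
    {n : ℕ} (hn : n ≠ 0) (s : Set E) (hs : MeasurableSet s) :
    ∫⁻ x, ((empDist x s - P s) + (P s - empDist x s)) ∂(prodn P n)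
      ≤ ENNReal.ofReal (4 / √n) := by
  have hn0 : (0 : ℝ) < n := by exact_mod_cast Nat.pos_of_ne_zero hn
  let Y : E → ℝ := s.indicator (fun _ => (n : ℝ)⁻¹)
  have hY : Measurable Y := measurable_const.indicator hs
  have hYb : ∀ y, Y y ∈ Set.Icc 0 (n : ℝ)⁻¹ := by
    intro y
    by_cases h : y ∈ s <;> simp [Y, h]
  have hYL : MemLp Y 2 P := by
    apply MemLp.of_bound hY.aestronglyMeasurable (n : ℝ)⁻¹
    filter_upwards with y
    rw [Real.norm_eq_abs, abs_of_nonneg (hYb y).1]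
    exact (hYb y).2
  let S : (Fin n → E) → ℝ := ∑ i, fun x => Y (x i)
  have hS : Measurable S := by
    show Measurable (∑ i, fun x : Fin n → E => Y (x i))
    fun_prop
  have : IsProbabilityMeasure (prodn P n) := by unfold prodn; infer_instance
  have hcomp : ∀ i : Fin n, MemLp (fun x : Fin n → E => Y (x i)) 2 (prodn P n) := fun i =>
    hYL.comp_measurePreserving (measurePreserving_eval (fun _ : Fin n => P) i)
  have hSL : MemLp S 2 (prodn P n) := memLp_finsetSum' _ fun i _ => hcomp i
  have hvar : ProbabilityTheory.variance S (prodn P n) ≤ (n : ℝ)⁻¹ := by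
    have h1 : ProbabilityTheory.variance S (prodn P n)
        = ∑ _i : Fin n, ProbabilityTheory.variance Y P :=
      ProbabilityTheory.variance_sum_pi (X := fun _ : Fin n => Y) (fun _ => hYL)
    rw [h1]
    have h2 := ProbabilityTheory.variance_le_sq_of_bounded (μ := P)
      (Filter.Eventually.of_forall hYb) hY.aemeasurable
    simp only [Finset.sum_const, Finset.card_univ, Fintype.card_fin, nsmul_eq_mul]
    calc (n : ℝ) * _ ≤ n * (((n : ℝ)⁻¹ - 0) / 2) ^ 2 := by gcongr
      _ = (n : ℝ)⁻¹ / 4 := by field_simp; norm_num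
      _ ≤ _ := by
        have : 0 < (n : ℝ)⁻¹ := by positivity
        linarith
  have hmean : ∫ x, S x ∂(prodn P n) = P.real s := by
    have h1 : ∀ i : Fin n, ∫ x, Y (x i) ∂(prodn P n) = P.real s * (n : ℝ)⁻¹ := by
      intro i
      have h2 : ∫ x, Y (x i) ∂(prodn P n) = ∫ y, Y y ∂P := by
        have := (measurePreserving_eval (fun _ : Fin n => P) i)
        have h3 := integral_map (f := Y) (μ := Measure.pi fun _ : Fin n => P) this.measurable.aemeasurable hY.aestronglyMeasurable
        rw [this.map_eq] at h3
        exact h3.symm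
      rw [h2, integral_indicator_const _ hs, smul_eq_mul]
    simp only [S, Finset.sum_apply]
    rw [integral_finsetSum _ fun i _ => (hcomp i).integrable (by norm_num)]
    simp only [h1, Finset.sum_const, Finset.card_univ, Fintype.card_fin, nsmul_eq_mul]
    field_simp
  have hevar : ∫⁻ x, ENNReal.ofReal ((S x - P.real s) ^ 2) ∂(prodn P n)
      ≤ ENNReal.ofReal (n : ℝ)⁻¹ := by
    rw [← hmean, ← ProbabilityTheory.evariance_eq_lintegral_ofReal,
      ← ProbabilityTheory.ofReal_variance hSL]
    exact ENNReal.ofReal_le_ofReal hvar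
  have hemp : ∀ x : Fin n → E, empDist x s = ENNReal.ofReal (S x) := by
    intro x
    simp only [S, Finset.sum_apply]
    rw [ENNReal.ofReal_sum_of_nonneg fun i _ => (hYb _).1]
    simp only [empDist, Measure.smul_apply, Measure.finsetSum_apply, smul_eq_mul,
      Measure.dirac_apply' _ hs]
    rw [Finset.mul_sum]
    refine Finset.sum_congr rfl fun i _ => ?_
    by_cases h : x i ∈ s
    · simp [Y, h, ENNReal.ofReal_inv_of_pos hn0]
    · simp [Y, h]
  have hPs : P s = ENNReal.ofReal (P.real s) := by simp
  have hsq : 0 < √(n : ℝ) := Real.sqrt_pos.2 hn0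
  have hss : √(n : ℝ) * √(n : ℝ) = n := Real.mul_self_sqrt hn0.le
  have hpt : ∀ x : Fin n → E, (empDist x s - P s) + (P s - empDist x s)
      ≤ ENNReal.ofReal (2 / √n) + ENNReal.ofReal (2 * √n) *
        ENNReal.ofReal ((S x - P.real s) ^ 2) := by
    intro x
    have hS0 : 0 ≤ S x := by
      simp only [S, Finset.sum_apply]
      exact Finset.sum_nonneg fun i _ => (hYb _).1
    rw [hemp, hPs, ← ENNReal.ofReal_sub _ measureReal_nonneg, ← ENNReal.ofReal_sub _ hS0,
      ← ENNReal.ofReal_mul (by positivity),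
      ← ENNReal.ofReal_add (p := 2 / √(n : ℝ)) (by positivity) (by positivity)]
    set t := S x - P.real s with ht
    have h1 : |t| ≤ 1 / √n + √n * t ^ 2 := by
      rw [← sq_abs]
      rw [div_add' _ _ _ hsq.ne', le_div_iff₀ hsq]
      nlinarith [sq_nonneg (|t| * √n - 1)]
    calc _ ≤ ENNReal.ofReal |t| + ENNReal.ofReal |t| := by
          refine add_le_add (ENNReal.ofReal_le_ofReal (le_abs_self t))
            (ENNReal.ofReal_le_ofReal ?_)
          rw [ht, abs_sub_comm]
          exact le_abs_self _
      _ = ENNReal.ofReal (|t| + |t|) := (ENNReal.ofReal_add (abs_nonneg _) (abs_nonneg _)).symm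
      _ ≤ _ := by
        apply ENNReal.ofReal_le_ofReal
        have : 2 / √(n : ℝ) = 2 * (1 / √n) := by ring
        rw [this]
        linarith
  calc _ ≤ _ := lintegral_mono hpt
    _ = ENNReal.ofReal (2 / √n) + ENNReal.ofReal (2 * √n) *
        ∫⁻ x, ENNReal.ofReal ((S x - P.real s) ^ 2) ∂(prodn P n) := by
        rw [lintegral_add_left measurable_const, lintegral_const_mul _ (by fun_prop)]
        simp
    _ ≤ ENNReal.ofReal (2 / √n) + ENNReal.ofReal (2 * √n) * ENNReal.ofReal (n : ℝ)⁻¹ := by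
        gcongr
    _ = _ := by
        rw [← ENNReal.ofReal_mul (by positivity), ← ENNReal.ofReal_add (by positivity) (by positivity)]
        congr 1
        have : (n : ℝ)⁻¹ = 1 / (√n * √n) := by rw [hss]; simp
        rw [this]
        field_simp
        norm_num

lemma aux_meas_emp {E : Type*} [MeasurableSpace E] {n : ℕ} (s : Set E) (hs : MeasurableSet s) :
    Measurable fun x : Fin n → E => empDist x s := by
  simp only [empDist, Measure.smul_apply, Measure.finsetSum_apply, smul_eq_mul,
      Measure.dirac_apply' _ hs]
  have : Measurable (s.indicator (1 : E → ℝ≥0∞)) := measurable_one.indicator hs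
  fun_prop

lemma aux_meas_int {E : Type*} [MeasurableSpace E] {n : ℕ} (a : E → ℝ≥0∞) (ha : Measurable a)
    (s : Set E) (hs : MeasurableSet s) :
    Measurable fun x : Fin n → E => ∫⁻ y in s, a y ∂(empDist x) := by
  have hi : Measurable (s.indicator a) := ha.indicator hs
  simp_rw [← lintegral_indicator hs, empDist, lintegral_smul_measure, lintegral_finsetSum_measure,
    lintegral_dirac' _ hi, smul_eq_mul]
  fun_prop

lemma aux_bound {E : Type*} [NormedAddCommGroup E] [MeasurableSpace E] [BorelSpace E]
    [SecondCountableTopology E]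
    (p : ℝ) (hp : 1 ≤ p) (P : Measure E) [IsProbabilityMeasure P]
    (f : E → ℕ) (hf : Measurable f) (K : ℕ) (hK : ∀ x, f x < K) (R ε : ℝ)
    (h0 : ∀ x, f x = 0 ↔ R < ‖x‖)
    (hε : ∀ x y, f x ≠ 0 → f x = f y → ‖x - y‖ ≤ ε) (n : ℕ) (hn : n ≠ 0) :
    ∫⁻ x, WpPow p (empDist x) P ∂(prodn P n) ≤
      ENNReal.ofReal (ε ^ p) + ENNReal.ofReal (2 ^ p) *
        (2 * ∫⁻ x in {x : E | R < ‖x‖}, ENNReal.ofReal (‖x‖ ^ p) ∂P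
          + K * (ENNReal.ofReal (R ^ p) * ENNReal.ofReal (4 / √n))) := by
  have : IsProbabilityMeasure (prodn P n) := by unfold prodn; infer_instance
  have ha : Measurable fun x : E => ENNReal.ofReal (‖x‖ ^ p) := by fun_prop
  have hs : MeasurableSet {x : E | R < ‖x‖} := measurableSet_lt measurable_const measurable_norm
  have hA : ∀ j, MeasurableSet (f ⁻¹' {j}) := fun j => hf (measurableSet_singleton j)
  have hme : ∀ j, Measurable fun x : Fin n → E => empDist x (f ⁻¹' {j}) := fun j =>
    aux_meas_emp _ (hA j)
  have hpt : ∀ x : Fin n → E, WpPow p (empDist x) P ≤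
      ENNReal.ofReal (ε ^ p) + ENNReal.ofReal (2 ^ p) *
        ((∫⁻ x in {x : E | R < ‖x‖}, ENNReal.ofReal (‖x‖ ^ p) ∂P
          + ∫⁻ x in {x : E | R < ‖x‖}, ENNReal.ofReal (‖x‖ ^ p) ∂(empDist x))
          + ∑ j ∈ (Finset.range K).erase 0, ENNReal.ofReal (R ^ p) *
            ((empDist x (f ⁻¹' {j}) - P (f ⁻¹' {j}))
              + (P (f ⁻¹' {j}) - empDist x (f ⁻¹' {j})))) := by
    intro x
    have := aux_emp_prob hn x
    refine (aux_det p hp P (empDist x) f hf K hK R ε h0 hε).trans (le_of_eq ?_)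
    simp_rw [mul_add (ENNReal.ofReal (R ^ p)), Finset.sum_add_distrib]
    congr 2
    ring
  refine (lintegral_mono hpt).trans ?_
  have hmd : ∀ j, Measurable fun x : Fin n → E => (empDist x (f ⁻¹' {j}) - P (f ⁻¹' {j}))
              + (P (f ⁻¹' {j}) - empDist x (f ⁻¹' {j})) := fun j =>
    ((hme j).sub_const _).add ((hme j).const_sub _)
  have hmi := aux_meas_int (n := n) _ ha _ hs
  have hmsum : Measurable fun x : Fin n → E =>
      ∑ j ∈ (Finset.range K).erase 0, ENNReal.ofReal (R ^ p) *
            ((empDist x (f ⁻¹' {j}) - P (f ⁻¹' {j}))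
              + (P (f ⁻¹' {j}) - empDist x (f ⁻¹' {j}))) :=
    Finset.measurable_fun_sum _ fun j _ => (hmd j).const_mul _
  rw [lintegral_add_left measurable_const, lintegral_const_mul _ (by exact (hmi.const_add _).add hmsum),
    lintegral_add_right _ hmsum, lintegral_add_left measurable_const, aux_mean P hn _ ha _ hs,
    lintegral_finsetSum _ fun j _ => (hmd j).const_mul _]
  simp only [lintegral_const, measure_univ, mul_one]
  rw [two_mul]
  gcongr
  calc _ ≤ ∑ j ∈ (Finset.range K).erase 0,
        ENNReal.ofReal (R ^ p) * ENNReal.ofReal (4 / √n) := by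
        refine Finset.sum_le_sum fun j _ => ?_
        rw [lintegral_const_mul _ (hmd j)]
        gcongr
        exact aux_var P hn _ (hA j)
    _ ≤ ∑ j ∈ Finset.range K, ENNReal.ofReal (R ^ p) * ENNReal.ofReal (4 / √n) :=
        Finset.sum_le_sum_of_subset (Finset.erase_subset _ _)
    _ = _ := by simp

/-- Uniform law of large numbers for the empirical measure in Wasserstein
distance, in `p`-th mean: if the `p`-th moments are uniformly integrable over `M`, i.e.
`lim_{r→∞} sup_{P∈M} ∫_{‖x‖>r} ‖x‖^p dP = 0`, then
`lim_{n→∞} sup_{P∈M} E_P[W_p^p(P̂_n, P)] = 0`. -/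
theorem empirical_Wasserstein_unif_LLN_mean {d : ℕ} (p : ℝ) (hp : 1 ≤ p)
    (M : Set (Measure (Euc d)))
    (hprob : ∀ P ∈ M, IsProbabilityMeasure P)
    (hmom : ∀ P ∈ M, HasFinMom p P)
    (hui : Tendsto (fun r : ℝ =>
        ⨆ P ∈ M, ∫⁻ x in {x : Euc d | r < ‖x‖}, ENNReal.ofReal (‖x‖ ^ p) ∂P)
      atTop (𝓝 0)) :
    Tendsto (fun n : ℕ => ⨆ P ∈ M, ∫⁻ x, WpPow p (empDist x) P ∂(prodn P n))
      atTop (𝓝 0) := by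
  rw [ENNReal.tendsto_nhds_zero]
  intro η hη
  have h3 : (0 : ℝ≥0∞) < η / 3 := ENNReal.div_pos hη.ne' (by norm_num)
  obtain ⟨ε, hε0, hε⟩ : ∃ ε : ℝ, 0 < ε ∧ ENNReal.ofReal (ε ^ p) ≤ η / 3 := by
    have h1 : Tendsto (fun ε : ℝ => ENNReal.ofReal (ε ^ p)) (𝓝[>] 0) (𝓝 0) := by
      have h2 : ContinuousAt (fun ε : ℝ => ENNReal.ofReal (ε ^ p)) 0 :=
        ENNReal.continuous_ofReal.continuousAt.comp
          (Real.continuousAt_rpow_const _ _ (Or.inr (by linarith)))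
      have h4 := h2.tendsto
      simp only [Real.zero_rpow (by linarith : p ≠ 0), ENNReal.ofReal_zero] at h4
      exact h4.mono_left nhdsWithin_le_nhds
    have h2 := (ENNReal.tendsto_nhds_zero.1 h1 _ h3).and self_mem_nhdsWithin
    obtain ⟨ε, h, h'⟩ := h2.exists
    exact ⟨ε, h', h⟩
  obtain ⟨R, hR⟩ : ∃ R : ℝ, ENNReal.ofReal (2 ^ p) * (2 *
      ⨆ P ∈ M, ∫⁻ x in {x : Euc d | R < ‖x‖}, ENNReal.ofReal (‖x‖ ^ p) ∂P) ≤ η / 3 := by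
    have h1 := ENNReal.Tendsto.const_mul (a := ENNReal.ofReal (2 ^ p))
      (ENNReal.Tendsto.const_mul (a := 2) hui (Or.inr (by norm_num))) (Or.inr ENNReal.ofReal_ne_top)
    simp only [mul_zero] at h1
    exact (ENNReal.tendsto_nhds_zero.1 h1 _ h3).exists
  obtain ⟨f, K, hf, hK, h0, hd⟩ := aux_part (E := Euc d) R ε hε0
  have hlim : Tendsto (fun n : ℕ => ENNReal.ofReal (2 ^ p) *
      (K * (ENNReal.ofReal (R ^ p) * ENNReal.ofReal (4 / √n)))) atTop (𝓝 0) := by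
    have h1 : Tendsto (fun n : ℕ => 4 / √(n : ℝ)) atTop (𝓝 0) :=
      (Real.tendsto_sqrt_atTop.comp tendsto_natCast_atTop_atTop).const_div_atTop 4
    have h2 := ENNReal.tendsto_ofReal h1
    have h4 := ENNReal.Tendsto.const_mul (a := ENNReal.ofReal (2 ^ p))
      (ENNReal.Tendsto.const_mul (a := (K : ℝ≥0∞))
      (ENNReal.Tendsto.const_mul (a := ENNReal.ofReal (R ^ p)) h2 (Or.inr ENNReal.ofReal_ne_top))
      (Or.inr (ENNReal.natCast_ne_top K))) (Or.inr ENNReal.ofReal_ne_top)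
    simpa using h4
  filter_upwards [ENNReal.tendsto_nhds_zero.1 hlim _ h3, eventually_ne_atTop 0] with n hn hn0
  refine iSup₂_le fun P hP => ?_
  have := hprob P hP
  refine (aux_bound p hp P f hf K hK R ε h0 hd n hn0).trans ?_
  rw [mul_add]
  calc _ ≤ η / 3 + (η / 3 + η / 3) := by
        refine add_le_add hε (add_le_add (le_trans ?_ hR) hn)
        gcongr
        exact le_iSup₂ (f := fun P (_ : P ∈ M) =>
          ∫⁻ x in {x : Euc d | R < ‖x‖}, ENNReal.ofReal (‖x‖ ^ p) ∂P) P hP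
    _ = η := by rw [← add_assoc, ENNReal.add_thirds]
end
end

section
/- (Corollary: uniform law of large numbers for the empirical measure in Wasserstein distance, in probability.) Let p ∈ [1,∞) and let M be a family of Borel probability measures on ℝ^d with finite p-th moments such that lim_{r→∞} sup_{P∈M} ∫_{‖x‖>r} ‖x‖^p dP(x) = 0. Then for every ε > 0, lim_{n→∞} sup_{P∈M} Pⁿ[ W_p^p(P̂_n, P) > ε ] = 0; that is, W_p^p(P̂_n, P) → 0 in probability as n → ∞, uniformly in P ∈ M. -/
open MeasureTheory ENNReal Filter Topology

noncomputable section

section helpers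
open scoped Classical in
theorem exists_coupling {E ι : Type*} [MeasurableSpace E] [Fintype ι] (P Q : Measure E)
    [IsProbabilityMeasure P] [IsProbabilityMeasure Q] (A : ι → Set E)
    (hA : ∀ k, MeasurableSet (A k)) (hd : Pairwise (Function.onFun Disjoint A))
    (hU : ⋃ k, A k = Set.univ) :
    ∃ γ ∈ couplings P Q, γ {z | ∀ k, ¬ (z.1 ∈ A k ∧ z.2 ∈ A k)} ≤ ∑ k, (P (A k) - Q (A k)) := by
  have key : ∀ R : Measure E, R = ∑ k, R.restrict (A k) := by
    intro R
    rw [← Measure.sum_fintype, ← Measure.restrict_iUnion hd hA, hU, Measure.restrict_univ]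
  have key1 : ∀ R : Measure E, IsProbabilityMeasure R → ∑ k, R (A k) = 1 := by
    intro R hR
    have h := congrArg (fun S : Measure E => S Set.univ) (key R)
    simpa using h.symm
  set a : ι → ℝ≥0∞ := fun k => P (A k) with ha
  set b : ι → ℝ≥0∞ := fun k => Q (A k) with hb
  set m : ι → ℝ≥0∞ := fun k => max (a k) (b k) with hm
  have hat : ∀ k, a k ≠ ∞ := fun k => measure_ne_top _ _
  have hbt : ∀ k, b k ≠ ∞ := fun k => measure_ne_top _ _
  have hmt : ∀ k, m k ≠ ∞ := fun k => by simp [hm, hat, hbt]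
  set γ1 : Measure (E × E) := ∑ k, (m k)⁻¹ • (P.restrict (A k)).prod (Q.restrict (A k)) with hγ1
  set P' : Measure E := ∑ k, (1 - (m k)⁻¹ * b k) • P.restrict (A k) with hP'
  set Q' : Measure E := ∑ k, (1 - (m k)⁻¹ * a k) • Q.restrict (A k) with hQ'
  have hb1 : ∀ k, (m k)⁻¹ * b k ≤ 1 := fun k => by
    rw [mul_comm, ← div_eq_mul_inv]
    exact ENNReal.div_le_of_le_mul (by simp [hm])
  have ha1 : ∀ k, (m k)⁻¹ * a k ≤ 1 := fun k => by
    rw [mul_comm, ← div_eq_mul_inv]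
    exact ENNReal.div_le_of_le_mul (by simp [hm])
  have aux : ∀ x y : ℝ≥0∞, x ≠ ∞ → y ≠ ∞ → (1 - (max x y)⁻¹ * y) * x = x - y := by
    intro x y hx hy
    rcases le_total x y with h | h
    · rw [max_eq_right h, tsub_eq_zero_of_le h]
      rcases eq_or_ne y 0 with h0 | h0
      · have : x = 0 := le_antisymm (h0 ▸ h) bot_le
        simp [this]
      · rw [ENNReal.inv_mul_cancel h0 hy]; simp
    · rw [max_eq_left h]
      rcases eq_or_ne x 0 with h0 | h0
      · simp [h0]
      · rw [ENNReal.sub_mul (fun _ _ => hx), mul_right_comm, ENNReal.inv_mul_cancel h0 hx]; simp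
  have hP'u : P' Set.univ = ∑ k, (a k - b k) := by
    simp only [hP', Measure.coe_finsetSum, Finset.sum_apply, Measure.smul_apply, smul_eq_mul,
      Measure.restrict_apply_univ]
    exact Finset.sum_congr rfl fun k _ => aux _ _ (hat k) (hbt k)
  have hQ'u : Q' Set.univ = ∑ k, (b k - a k) := by
    simp only [hQ', Measure.coe_finsetSum, Finset.sum_apply, Measure.smul_apply, smul_eq_mul,
      Measure.restrict_apply_univ]
    refine Finset.sum_congr rfl fun k _ => ?_
    have := aux _ _ (hbt k) (hat k)
    rwa [max_comm] at this
  set s := ∑ k, (a k - b k) with hs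
  have hst : s ≠ ∞ := by
    simp [hs, ENNReal.sum_eq_top, ENNReal.sub_eq_top_iff, hat]
  have hss : ∑ k, (b k - a k) = s := by
    have h1 : s + ∑ k, b k = ∑ k, (b k - a k) + ∑ k, a k := by
      rw [hs, ← Finset.sum_add_distrib, ← Finset.sum_add_distrib]
      refine Finset.sum_congr rfl fun k _ => ?_
      rw [tsub_add_eq_max, tsub_add_eq_max, max_comm]
    rw [key1 P inferInstance, key1 Q inferInstance] at h1
    exact ((ENNReal.add_left_inj one_ne_top).1 h1).symm
  rw [hss] at hQ'u
  have : IsFiniteMeasure P' := ⟨by rw [hP'u]; exact hst.lt_top⟩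
  have : IsFiniteMeasure Q' := ⟨by rw [hQ'u]; exact hst.lt_top⟩
  set γ : Measure (E × E) := γ1 + s⁻¹ • P'.prod Q' with hγ
  have hf : γ.map Prod.fst = P := by
    have h1 : γ1.map Prod.fst = ∑ k, ((m k)⁻¹ * b k) • P.restrict (A k) := by
      rw [hγ1, Measure.map_finset_sum measurable_fst.aemeasurable]
      refine Finset.sum_congr rfl fun k _ => ?_
      rw [Measure.map_smul, Measure.map_fst_prod, Measure.restrict_apply_univ, smul_smul]
    have h2 : (s⁻¹ • P'.prod Q').map Prod.fst = P' := by
      rw [Measure.map_smul, Measure.map_fst_prod, hQ'u, smul_smul]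
      rcases eq_or_ne s 0 with h0 | h0
      · have : P' = 0 := Measure.measure_univ_eq_zero.1 (by rw [hP'u, h0])
        simp [this]
      · rw [ENNReal.inv_mul_cancel h0 hst, one_smul]
    rw [hγ, Measure.map_add _ _ measurable_fst, h1, h2, hP', ← Finset.sum_add_distrib]
    conv_rhs => rw [key P]
    refine Finset.sum_congr rfl fun k _ => ?_
    rw [← add_smul, add_tsub_cancel_of_le (hb1 k), one_smul]
  have hg : γ.map Prod.snd = Q := by
    have h1 : γ1.map Prod.snd = ∑ k, ((m k)⁻¹ * a k) • Q.restrict (A k) := by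
      rw [hγ1, Measure.map_finset_sum measurable_snd.aemeasurable]
      refine Finset.sum_congr rfl fun k _ => ?_
      rw [Measure.map_smul, Measure.map_snd_prod, Measure.restrict_apply_univ, smul_smul]
    have h2 : (s⁻¹ • P'.prod Q').map Prod.snd = Q' := by
      rw [Measure.map_smul, Measure.map_snd_prod, hP'u, smul_smul]
      rcases eq_or_ne s 0 with h0 | h0
      · have : Q' = 0 := Measure.measure_univ_eq_zero.1 (by rw [hQ'u, h0])
        simp [this]
      · rw [ENNReal.inv_mul_cancel h0 hst, one_smul]
    rw [hγ, Measure.map_add _ _ measurable_snd, h1, h2, hQ', ← Finset.sum_add_distrib]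
    conv_rhs => rw [key Q]
    refine Finset.sum_congr rfl fun k _ => ?_
    rw [← add_smul, add_tsub_cancel_of_le (ha1 k), one_smul]
  refine ⟨γ, ⟨⟨?_⟩, hf, hg⟩, ?_⟩
  · have h := congrArg (fun S : Measure E => S Set.univ) hf
    simpa [Measure.map_apply measurable_fst] using h
  · have hD : MeasurableSet {z : E × E | ∀ k, ¬ (z.1 ∈ A k ∧ z.2 ∈ A k)} := by
      rw [Set.ofPred_forall]
      refine MeasurableSet.iInter fun k => ?_
      exact ((hA k).prod (hA k)).compl
    have h1 : γ1 {z : E × E | ∀ k, ¬ (z.1 ∈ A k ∧ z.2 ∈ A k)} = 0 := by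
      simp only [hγ1, Measure.coe_finsetSum, Finset.sum_apply, Measure.smul_apply, smul_eq_mul]
      refine Finset.sum_eq_zero fun k _ => ?_
      rw [Measure.prod_restrict, Measure.restrict_apply hD]
      have : {z : E × E | ∀ k, ¬ (z.1 ∈ A k ∧ z.2 ∈ A k)} ∩ A k ×ˢ A k = ∅ := by
        ext z
        simp only [Set.mem_inter_iff, Set.mem_ofPred_eq, Set.mem_prod, Set.mem_empty_iff_false,
          iff_false]
        exact fun h => h.1 k h.2
      rw [this]; simp
    rw [hγ, Measure.add_apply, h1, zero_add, Measure.smul_apply, smul_eq_mul]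
    calc s⁻¹ * (P'.prod Q') _ ≤ s⁻¹ * (P'.prod Q') Set.univ := by gcongr; exact Set.subset_univ _
      _ = s⁻¹ * (s * s) := by rw [← Set.univ_prod_univ, Measure.prod_prod, hP'u, hQ'u]
      _ = (s⁻¹ * s) * s := by ring
      _ ≤ 1 * s := by gcongr; exact ENNReal.inv_mul_le_one s
      _ = s := one_mul s

theorem exists_cells {d : ℕ} (r δ : ℝ) (hδ : 0 < δ) :
    ∃ (N : ℕ) (A : Fin N → Set (Euc d)), (∀ k, MeasurableSet (A k)) ∧
      Pairwise (Function.onFun Disjoint A) ∧ (⋃ k, A k = Set.univ) ∧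
      ∀ k x y, x ∈ A k → y ∈ A k → ‖x - y‖ ≤ δ ∨ (r < ‖x‖ ∧ r < ‖y‖) := by
  classical
  obtain ⟨t, ht, hcov⟩ := Metric.totallyBounded_iff.1
    (isCompact_closedBall (0 : Euc d) r).totallyBounded (δ / 2) (half_pos hδ)
  have : Fintype t := ht.fintype
  let e := Fintype.equivFin (Set t)
  let c : Euc d → Set t := fun x => {i | x ∈ Metric.ball (i : Euc d) (δ / 2)}
  refine ⟨_, fun k => {x | c x = e.symm k}, ?_, ?_, ?_, ?_⟩
  · intro k
    have : {x | c x = e.symm k} =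
        ⋂ i : t, {x | x ∈ Metric.ball (i : Euc d) (δ / 2) ↔ i ∈ e.symm k} := by
      ext x
      simp [c, Set.ext_iff]
    change MeasurableSet {x | c x = e.symm k}
    rw [this]
    refine MeasurableSet.iInter fun i => ?_
    by_cases h : i ∈ e.symm k
    · simp only [h, iff_true]; exact Metric.isOpen_ball.measurableSet
    · simp only [h, iff_false]; exact Metric.isOpen_ball.measurableSet.compl
  · intro k l hkl
    refine Set.disjoint_left.2 fun x hx hy => hkl ?_
    exact e.symm.injective (hx.symm.trans hy)
  · refine Set.eq_univ_of_forall fun x => Set.mem_iUnion.2 ⟨e (c x), by simp⟩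
  · intro k x y hx hy
    have hxy : c x = c y := hx.trans hy.symm
    have hout : ∀ z, ‖z‖ ≤ r → ∃ i : t, i ∈ c z := by
      intro z hz
      have := hcov (show z ∈ Metric.closedBall 0 r by simpa using hz)
      simp only [Set.mem_iUnion] at this
      obtain ⟨i, hi, h⟩ := this
      exact ⟨⟨i, hi⟩, h⟩
    by_cases hne : ∃ i, i ∈ c x
    · obtain ⟨i, hi⟩ := hne
      left
      have h1 : dist x i < δ / 2 := hi
      have h2 : dist y i < δ / 2 := by rw [hxy] at hi; exact hi
      rw [← dist_eq_norm]
      linarith [dist_triangle_right x y i]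
    · right
      constructor
      · by_contra h; exact hne (hout x (not_lt.1 h))
      · by_contra h; exact hne (hxy ▸ hout y (not_lt.1 h))

theorem rpow_sub_le {d : ℕ} (p : ℝ) (hp : 1 ≤ p) (x y : Euc d) :
    ‖x - y‖ ^ p ≤ 2 ^ p * (‖x‖ ^ p + ‖y‖ ^ p) := by
  have hp0 : 0 ≤ p := by linarith
  have h1 : ‖x - y‖ ≤ 2 * max ‖x‖ ‖y‖ := by
    have := norm_sub_le x y
    have := le_max_left ‖x‖ ‖y‖
    have := le_max_right ‖x‖ ‖y‖
    linarith
  calc ‖x - y‖ ^ p ≤ (2 * max ‖x‖ ‖y‖) ^ p := Real.rpow_le_rpow (norm_nonneg _) h1 hp0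
    _ = 2 ^ p * (max ‖x‖ ‖y‖) ^ p := Real.mul_rpow (by norm_num) (by positivity)
    _ ≤ _ := by
      gcongr
      have hx : 0 ≤ ‖x‖ ^ p := by positivity
      have hy : 0 ≤ ‖y‖ ^ p := by positivity
      rcases max_choice ‖x‖ ‖y‖ with h | h <;> rw [h] <;> linarith

def tailF {d : ℕ} (p r : ℝ) : Euc d → ℝ≥0∞ :=
  Set.indicator {x : Euc d | r < ‖x‖} fun x => ENNReal.ofReal (‖x‖ ^ p)

theorem measurableSet_tail {d : ℕ} (r : ℝ) : MeasurableSet {x : Euc d | r < ‖x‖} :=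
  measurableSet_lt measurable_const measurable_norm

theorem measurable_tailF {d : ℕ} (p r : ℝ) : Measurable (tailF (d := d) p r) :=
  (by fun_prop : Measurable fun x : Euc d => ENNReal.ofReal (‖x‖ ^ p)).indicator
    (measurableSet_tail r)

theorem le_tailF {d : ℕ} (p r : ℝ) (hp : 1 ≤ p) (x : Euc d) :
    ENNReal.ofReal (‖x‖ ^ p) ≤ ENNReal.ofReal (r ^ p) + tailF p r x := by
  by_cases h : r < ‖x‖
  · simp [tailF, h]
  · refine le_trans ?_ le_self_add
    exact ENNReal.ofReal_le_ofReal
      (Real.rpow_le_rpow (norm_nonneg _) (not_lt.1 h) (by linarith))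

theorem WpPow_le {d : ℕ} (p : ℝ) (hp : 1 ≤ p) (r δ : ℝ) (hδ : 0 < δ) {N : ℕ}
    (A : Fin N → Set (Euc d)) (hA : ∀ k, MeasurableSet (A k))
    (hd : Pairwise (Function.onFun Disjoint A)) (hU : ⋃ k, A k = Set.univ)
    (hc : ∀ k x y, x ∈ A k → y ∈ A k → ‖x - y‖ ≤ δ ∨ (r < ‖x‖ ∧ r < ‖y‖))
    (P Q : Measure (Euc d)) [IsProbabilityMeasure P] [IsProbabilityMeasure Q] :
    WpPow p Q P ≤ ENNReal.ofReal (δ ^ p) + ENNReal.ofReal (2 ^ p) *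
      (2 * ENNReal.ofReal (r ^ p) * (∑ k, (Q (A k) - P (A k)))
        + ∫⁻ x, tailF p r x ∂Q + ∫⁻ x, tailF p r x ∂P) := by
  obtain ⟨γ, hγ, hγD⟩ := exists_coupling Q P A hA hd hU
  have := hγ.1
  set D := {z : Euc d × Euc d | ∀ k, ¬ (z.1 ∈ A k ∧ z.2 ∈ A k)} with hDdef
  have hD : MeasurableSet D := by
    rw [hDdef, Set.ofPred_forall]
    exact MeasurableSet.iInter fun k => ((hA k).prod (hA k)).compl
  have hpt : ∀ z : Euc d × Euc d, ENNReal.ofReal (‖z.1 - z.2‖ ^ p) ≤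
      ENNReal.ofReal (δ ^ p) + ENNReal.ofReal (2 ^ p) *
        (D.indicator (fun _ => 2 * ENNReal.ofReal (r ^ p)) z + tailF p r z.1 + tailF p r z.2) := by
    rintro ⟨x, y⟩
    have hgen : ENNReal.ofReal (‖x - y‖ ^ p) ≤ ENNReal.ofReal (2 ^ p) *
        (ENNReal.ofReal (‖x‖ ^ p) + ENNReal.ofReal (‖y‖ ^ p)) := by
      rw [← ENNReal.ofReal_add (by positivity) (by positivity),
        ← ENNReal.ofReal_mul (by positivity)]
      exact ENNReal.ofReal_le_ofReal (rpow_sub_le p hp x y)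
    by_cases hz : (x, y) ∈ D
    · refine hgen.trans (le_trans ?_ le_add_self)
      refine mul_le_mul_right ?_ _
      rw [Set.indicator_of_mem hz]
      calc _ ≤ (ENNReal.ofReal (r ^ p) + tailF p r x) + (ENNReal.ofReal (r ^ p) + tailF p r y) :=
            add_le_add (le_tailF p r hp x) (le_tailF p r hp y)
        _ = _ := by ring
    · simp only [hDdef, Set.mem_ofPred_eq, not_forall, not_not] at hz
      obtain ⟨k, hx, hy⟩ := hz
      rcases hc k x y hx hy with h | ⟨h1, h2⟩
      · refine le_trans ?_ le_self_add
        exact ENNReal.ofReal_le_ofReal (Real.rpow_le_rpow (norm_nonneg _) h (by linarith))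
      · refine hgen.trans (le_trans ?_ le_add_self)
        refine mul_le_mul_right ?_ _
        have e1 : tailF p r x = ENNReal.ofReal (‖x‖ ^ p) := by simp [tailF, h1]
        have e2 : tailF p r y = ENNReal.ofReal (‖y‖ ^ p) := by simp [tailF, h2]
        rw [e1, e2, add_assoc]
        exact le_add_self
  have hm1 : Measurable fun z : Euc d × Euc d => tailF p r z.1 :=
    (measurable_tailF p r).comp measurable_fst
  have hm2 : Measurable fun z : Euc d × Euc d => tailF p r z.2 :=
    (measurable_tailF p r).comp measurable_snd
  have hm3 : Measurable (D.indicator fun _ => 2 * ENNReal.ofReal (r ^ p)) :=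
    measurable_const.indicator hD
  refine (iInf₂_le γ hγ).trans ((lintegral_mono hpt).trans ?_)
  rw [lintegral_add_left measurable_const, lintegral_const_mul _ (by fun_prop),
    lintegral_add_right _ hm2, lintegral_add_right _ hm1, lintegral_indicator_const hD]
  have e1 : ∫⁻ z, tailF p r z.1 ∂γ = ∫⁻ x, tailF p r x ∂Q := by
    rw [← hγ.2.1, lintegral_map (measurable_tailF p r) measurable_fst]
  have e2 : ∫⁻ z, tailF p r z.2 ∂γ = ∫⁻ x, tailF p r x ∂P := by
    rw [← hγ.2.2, lintegral_map (measurable_tailF p r) measurable_snd]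
  rw [e1, e2]
  simp only [lintegral_const, measure_univ, mul_one]
  gcongr

theorem lintegral_empDist {d n : ℕ} (x : Fin n → Euc d) (f : Euc d → ℝ≥0∞) (hf : Measurable f) :
    ∫⁻ y, f y ∂(empDist x) = (n : ℝ≥0∞)⁻¹ * ∑ i, f (x i) := by
  rw [empDist, lintegral_smul_measure, lintegral_finsetSum_measure]
  simp [lintegral_dirac' _ hf]

theorem empDist_prob {d n : ℕ} (hn : n ≠ 0) (x : Fin n → Euc d) :
    IsProbabilityMeasure (empDist x) := by
  constructor
  simp only [empDist, Measure.smul_apply, Measure.coe_finsetSum, Finset.sum_apply, measure_univ,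
    smul_eq_mul, Finset.sum_const, Finset.card_univ, Fintype.card_fin, nsmul_eq_mul, mul_one]
  exact ENNReal.inv_mul_cancel (by exact_mod_cast hn) (natCast_ne_top n)

theorem markov_tail {d n : ℕ} (hn : n ≠ 0) (P : Measure (Euc d)) [IsProbabilityMeasure P]
    (f : Euc d → ℝ≥0∞) (hf : Measurable f) (τ : ℝ≥0∞) (h0 : τ ≠ 0) (ht : τ ≠ ∞) :
    prodn P n {x | τ ≤ ∫⁻ y, f y ∂(empDist x)} ≤ (∫⁻ y, f y ∂P) / τ := by
  simp only [lintegral_empDist _ f hf]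
  refine (meas_ge_le_lintegral_div (Measurable.aemeasurable (by fun_prop)) h0 ht).trans ?_
  gcongr
  rw [lintegral_const_mul _ (by fun_prop), lintegral_finsetSum _ (by fun_prop)]
  have : ∀ i : Fin n, ∫⁻ x, f (x i) ∂(prodn P n) = ∫⁻ y, f y ∂P := fun i =>
    (measurePreserving_eval (fun _ : Fin n => P) i).lintegral_comp hf
  simp only [this, Finset.sum_const, Finset.card_univ, Fintype.card_fin, nsmul_eq_mul, ← mul_assoc]
  rw [ENNReal.inv_mul_cancel (by exact_mod_cast hn) (natCast_ne_top n), one_mul]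


theorem cheb_cell {d n : ℕ} (hn : n ≠ 0) (P : Measure (Euc d)) [IsProbabilityMeasure P]
    (A : Set (Euc d)) (hA : MeasurableSet A) (t : ℝ) (ht : 0 < t) :
    prodn P n {x | ENNReal.ofReal t ≤ empDist x A - P A} ≤
      ENNReal.ofReal (1 / (n * t ^ 2)) := by
  have hn' : (0 : ℝ) < n := by exact_mod_cast Nat.pos_of_ne_zero hn
  set f : Euc d → ℝ := A.indicator 1 with hf
  have hfm : Measurable f := measurable_one.indicator hA
  have hf01 : ∀ x, f x ∈ Set.Icc (0 : ℝ) 1 := by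
    intro x
    by_cases h : x ∈ A <;> simp [hf, h]
  have hfL : MemLp f 2 P := MemLp.of_bound hfm.aestronglyMeasurable 1
    (ae_of_all _ fun x => by rw [Real.norm_of_nonneg (hf01 x).1]; exact (hf01 x).2)
  have hfi : ∫ x, f x ∂P = P.real A := by
    rw [hf, integral_indicator_one hA]
  have hprob : IsProbabilityMeasure (prodn P n) := by unfold prodn; infer_instance
  set S : (Fin n → Euc d) → ℝ := ∑ i, fun x => f (x i) with hS
  have hmp : ∀ i : Fin n, MeasurePreserving (fun x : Fin n → Euc d => x i) (prodn P n) P :=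
    fun i => measurePreserving_eval (fun _ : Fin n => P) i
  have hfLi : ∀ i : Fin n, MemLp (fun x : Fin n → Euc d => f (x i)) 2 (prodn P n) :=
    fun i => hfL.comp_measurePreserving (hmp i)
  have hSL : MemLp S 2 (prodn P n) := memLp_finsetSum' _ fun i _ => hfLi i
  have hSv : ProbabilityTheory.variance S (prodn P n) ≤ n := by
    rw [hS, prodn, ProbabilityTheory.variance_sum_pi (X := fun _ => f) (fun _ => hfL)]
    have : ProbabilityTheory.variance f P ≤ 1 := by
      have := ProbabilityTheory.variance_le_sq_of_bounded (μ := P) (ae_of_all _ hf01)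
        hfm.aemeasurable
      norm_num at this
      linarith
    simp only [Finset.sum_const, Finset.card_univ, Fintype.card_fin, nsmul_eq_mul]
    nlinarith
  have hSi : ∫ x, S x ∂(prodn P n) = n * P.real A := by
    simp only [hS, Finset.sum_apply]
    rw [integral_finsetSum _ fun i _ => (hfLi i).integrable (by norm_num)]
    have : ∀ i : Fin n, ∫ x, f (x i) ∂(prodn P n) = P.real A := by
      intro i
      have h := integral_map (μ := prodn P n) (measurable_pi_apply i).aemeasurable
        (f := f) hfm.aestronglyMeasurable
      rw [← h, ← hfi]
      exact congrArg (fun ν : Measure (Euc d) => ∫ x, f x ∂ν) (hmp i).map_eq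
    simp [this]
  have hemp : ∀ x : Fin n → Euc d, empDist x A = ENNReal.ofReal (S x / n) := by
    intro x
    rw [ENNReal.ofReal_div_of_pos hn', ENNReal.ofReal_natCast, div_eq_mul_inv, mul_comm, hS,
      Finset.sum_apply, ENNReal.ofReal_sum_of_nonneg fun i _ => (hf01 (x i)).1]
    simp only [empDist, Measure.smul_apply, Measure.coe_finsetSum, Finset.sum_apply, smul_eq_mul]
    congr 1
    refine Finset.sum_congr rfl fun i _ => ?_
    rw [Measure.dirac_apply' _ hA]
    by_cases h : x i ∈ A <;> simp [hf, h]
  have hsub : {x : Fin n → Euc d | ENNReal.ofReal t ≤ empDist x A - P A} ⊆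
      {x | n * t ≤ |S x - ∫ y, S y ∂(prodn P n)|} := by
    intro x hx
    simp only [Set.mem_ofPred_eq] at hx ⊢
    rw [hemp, ← ofReal_measureReal, ← ENNReal.ofReal_sub _ measureReal_nonneg,
      ENNReal.ofReal_le_ofReal_iff'] at hx
    rcases hx with hx | hx
    · rw [hSi]
      refine le_trans ?_ (le_abs_self _)
      have : n * t ≤ n * (S x / n - P.real A) := by gcongr
      rwa [mul_sub, mul_div_cancel₀ _ hn'.ne'] at this
    · linarith
  refine (measure_mono hsub).trans
    ((ProbabilityTheory.meas_ge_le_variance_div_sq hSL (by positivity)).trans ?_)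
  refine ENNReal.ofReal_le_ofReal ?_
  calc _ ≤ (n : ℝ) / (n * t) ^ 2 := by gcongr
    _ = _ := by field_simp

end helpers

/-- Corollary: uniform law of large numbers for the empirical measure in
Wasserstein distance, in probability: if the `p`-th moments are uniformly integrable over
`M`, then for every `ε > 0`, `lim_{n→∞} sup_{P∈M} Pⁿ[W_p^p(P̂_n, P) > ε] = 0`. -/
theorem empirical_Wasserstein_unif_LLN_prob {d : ℕ} (p : ℝ) (hp : 1 ≤ p)
    (M : Set (Measure (Euc d)))
    (hprob : ∀ P ∈ M, IsProbabilityMeasure P)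
    (hmom : ∀ P ∈ M, HasFinMom p P)
    (hui : Tendsto (fun r : ℝ =>
        ⨆ P ∈ M, ∫⁻ x in {x : Euc d | r < ‖x‖}, ENNReal.ofReal (‖x‖ ^ p) ∂P)
      atTop (𝓝 0))
    (ε : ℝ) (hε : 0 < ε) :
    Tendsto (fun n : ℕ =>
        ⨆ P ∈ M, prodn P n {x | ENNReal.ofReal ε < WpPow p (empDist x) P})
      atTop (𝓝 0) := by
  rw [ENNReal.tendsto_nhds_zero]
  intro ε' hε'
  have hp0 : 0 < p := by linarith
  set C : ℝ := 2 ^ p with hC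
  have hCpos : 0 < C := by positivity
  set τ : ℝ := ε / (4 * C) with hτ
  have hτpos : 0 < τ := by positivity
  have hτ0 : ENNReal.ofReal τ ≠ 0 := by simpa using hτpos
  set η : ℝ≥0∞ := min (ENNReal.ofReal τ) (ε' / 2 * ENNReal.ofReal τ) with hη
  have hε2 : ε' / 2 ≠ 0 := (ENNReal.half_pos hε'.ne').ne'
  have hηpos : 0 < η := lt_min (pos_iff_ne_zero.2 hτ0) (pos_iff_ne_zero.2 (mul_ne_zero hε2 hτ0))
  obtain ⟨r, hr, hr1⟩ := ((ENNReal.tendsto_nhds_zero.1 hui η hηpos).and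
    (eventually_ge_atTop (1 : ℝ))).exists
  set δ : ℝ := (ε / 4) ^ (1 / p) with hδ
  have hδpos : 0 < δ := by positivity
  have hδp : δ ^ p = ε / 4 := by
    rw [hδ, ← Real.rpow_mul (by positivity), one_div_mul_cancel hp0.ne', Real.rpow_one]
  obtain ⟨N, A, hA, hd, hU, hc⟩ := exists_cells (d := d) r δ hδpos
  have hrp : 0 < r ^ p := by positivity
  set t : ℝ := ε / (8 * C * r ^ p * (N + 1)) with ht
  have htpos : 0 < t := by positivity
  have hlim : Tendsto (fun n : ℕ => (N : ℝ≥0∞) * ENNReal.ofReal (1 / (n * t ^ 2)))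
      atTop (𝓝 0) := by
    have h1 : Tendsto (fun n : ℕ => 1 / ((n : ℝ) * t ^ 2)) atTop (𝓝 0) := by
      have := (tendsto_one_div_atTop_nhds_zero_nat (𝕜 := ℝ)).mul_const (1 / t ^ 2)
      rw [zero_mul] at this
      refine this.congr fun n => ?_
      rw [div_mul_div_comm, one_mul]
    have h2 := ENNReal.tendsto_ofReal h1
    rw [ENNReal.ofReal_zero] at h2
    have h3 := ENNReal.Tendsto.const_mul (a := (N : ℝ≥0∞)) h2 (Or.inr (natCast_ne_top N))
    rwa [mul_zero] at h3
  filter_upwards [ENNReal.tendsto_nhds_zero.1 hlim (ε' / 2) (pos_iff_ne_zero.2 hε2),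
    eventually_ne_atTop 0] with n hn hn0
  refine iSup₂_le fun P hP => ?_
  have := hprob P hP
  have htail : ∫⁻ x, tailF p r x ∂P ≤ η := by
    refine le_trans ?_ hr
    simp only [tailF]
    rw [lintegral_indicator (measurableSet_tail r)]
    exact le_iSup₂ (f := fun (P : Measure (Euc d)) (_ : P ∈ M) =>
      ∫⁻ x in {x : Euc d | r < ‖x‖}, ENNReal.ofReal (‖x‖ ^ p) ∂P) P hP
  have hsub : {x : Fin n → Euc d | ENNReal.ofReal ε < WpPow p (empDist x) P} ⊆
      (⋃ k, {x | ENNReal.ofReal t ≤ empDist x (A k) - P (A k)}) ∪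
        {x | ENNReal.ofReal τ ≤ ∫⁻ y, tailF p r y ∂(empDist x)} := by
    intro x hx
    by_contra hcon
    simp only [Set.mem_union, Set.mem_iUnion, Set.mem_ofPred_eq, not_or, not_exists, not_le]
      at hcon hx
    obtain ⟨h1, h2⟩ := hcon
    have := empDist_prob hn0 x
    refine absurd hx (not_lt.2 ?_)
    refine (WpPow_le p hp r δ hδpos A hA hd hU hc P (empDist x)).trans ?_
    have hsum : ∑ k, (empDist x (A k) - P (A k)) ≤ ENNReal.ofReal (N * t) := by
      calc _ ≤ ∑ _k : Fin N, ENNReal.ofReal t := Finset.sum_le_sum fun k _ => (h1 k).le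
        _ = _ := by
          rw [ENNReal.ofReal_mul (by positivity)]
          simp
    calc _ ≤ ENNReal.ofReal (δ ^ p) + ENNReal.ofReal C *
          (ENNReal.ofReal 2 * ENNReal.ofReal (r ^ p) * ENNReal.ofReal (N * t)
            + ENNReal.ofReal τ + ENNReal.ofReal τ) := by
          rw [ENNReal.ofReal_ofNat]
          gcongr
          exact htail.trans (min_le_left _ _)
      _ = ENNReal.ofReal (δ ^ p + C * (2 * r ^ p * (N * t) + τ + τ)) := by
          rw [← ENNReal.ofReal_mul (by norm_num), ← ENNReal.ofReal_mul (by positivity),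
            ← ENNReal.ofReal_add (by positivity) (by positivity),
            ← ENNReal.ofReal_add (by positivity) (by positivity),
            ← ENNReal.ofReal_mul (by positivity),
            ← ENNReal.ofReal_add (by positivity) (by positivity)]
      _ ≤ ENNReal.ofReal ε := by
          refine ENNReal.ofReal_le_ofReal ?_
          have e1 : C * τ = ε / 4 := by rw [hτ]; field_simp
          have e2 : C * (2 * r ^ p * (N * t)) ≤ ε / 4 := by
            have : C * (2 * r ^ p * ((N + 1) * t)) = ε / 4 := by rw [ht]; field_simp; norm_num
            rw [← this]
            gcongr
            linarith
          rw [hδp]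
          nlinarith
  calc prodn P n _ ≤ _ := measure_mono hsub
    _ ≤ _ := measure_union_le _ _
    _ ≤ ε' / 2 + ε' / 2 := by
      refine add_le_add ?_ ?_
      · refine le_trans ((measure_iUnion_fintype_le _ _).trans
          (Finset.sum_le_sum fun k _ => cheb_cell hn0 P (A k) (hA k) t htpos)) ?_
        simpa using hn
      · refine (markov_tail hn0 P _ (measurable_tailF p r) _ hτ0 ofReal_ne_top).trans ?_
        exact ENNReal.div_le_of_le_mul (htail.trans (min_le_right _ _))
    _ = ε' := ENNReal.add_halves ε'
end
end
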